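/- arXiv:2109.04631 — 6 statements merged into one kernel-verified Lean document; each statement's English description precedes it below -/
import Mathlib

section
/- For any two binary relations r and s on a type α, the reflexive-transitive closure of their union equals the composition of the reflexive-transitive closure of r with the reflexive-transitive closure of the composition of s with the reflexive-transitive closure of r: ReflTransGen (r ⊔ s) = (ReflTransGen r) ∘ ReflTransGen (s ∘ ReflTransGen r), where (R ∘ S) x y means ∃ z, R x z ∧ S z y and R ⊔ S is pointwise disjunction. -/
open Relation

theorem reflTransGen_sup_eq_comp {α : Type*} (r s : α → α → Prop) :
    ReflTransGen (r ⊔ s) =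
      Relation.Comp (ReflTransGen r) (ReflTransGen (Relation.Comp s (ReflTransGen r))) := by
  have r_le {a b : α} (h : ReflTransGen r a b) : ReflTransGen (r ⊔ s) a b :=
    ReflTransGen.mono (fun _ _ => Or.inl) _ _ h
  ext x y
  constructor
  · intro h
    induction h using ReflTransGen.head_induction_on with
    | refl => exact ⟨y, .refl, .refl⟩
    | head step _ ih =>
      obtain ⟨z, hr, hs⟩ := ih
      rcases step with step | step
      · exact ⟨z, hr.head step, hs⟩
      · exact ⟨_, .refl, hs.head ⟨_, step, hr⟩⟩
  · rintro ⟨z, hr, hs⟩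
    refine (r_le hr).trans ?_
    induction hs with
    | refl => exact .refl
    | tail _ step ih =>
      obtain ⟨w, hsw, hrw⟩ := step
      exact (ih.tail (Or.inr hsw)).trans (r_le hrw)
end

section
/- Let α be an alphabet, S a type of states, and ρ : α → (S → S → Prop) an assignment of a transition relation to each letter. Define the relational interpretation I of regular expressions over α by: I(0) = the empty relation, I(ε) = equality, I(char c) = ρ c, I(p + q) = I(p) ⊔ I(q), I(p · q) = I(p) ∘ I(q) (relational composition), and I(p∗) = the reflexive-transitive closure of I(p). For a word w = [c₁, …, cₙ], let ρ⃗(w) = ρ(c₁) ∘ ⋯ ∘ ρ(cₙ) (with ρ⃗([]) = equality). Then for every regular expression e and all states x, y: I(e) x y holds if and only if there exists a word w in the language e.matches' such that ρ⃗(w) x y holds. -/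
open Relation

/-- The transition relation of a word: the composition of the transition
relations of its letters (equality for the empty word). -/
def relOfWord {α S : Type*} (ρ : α → S → S → Prop) : List α → S → S → Prop
  | [] => Eq
  | c :: w => Relation.Comp (ρ c) (relOfWord ρ w)

/-- The relational interpretation of a regular expression. -/
def interp {α S : Type*} (ρ : α → S → S → Prop) : RegularExpression α → S → S → Prop
  | RegularExpression.zero => fun _ _ => False
  | RegularExpression.epsilon => Eq
  | RegularExpression.char c => ρ c
  | RegularExpression.plus p q => interp ρ p ⊔ interp ρ q
  | RegularExpression.comp p q => Relation.Comp (interp ρ p) (interp ρ q)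
  | RegularExpression.star p => Relation.ReflTransGen (interp ρ p)

theorem relOfWord_append {α S : Type*} (ρ : α → S → S → Prop) (u v : List α) :
    relOfWord ρ (u ++ v) = Relation.Comp (relOfWord ρ u) (relOfWord ρ v) := by
  induction u with
  | nil => exact Relation.eq_comp.symm
  | cons c u ih => simp only [List.cons_append, relOfWord, ih, Relation.comp_assoc]

/-- The closure of the relation of a language is the relation of its Kleene star. -/
theorem reflTransGen_iff_exists_mem_kstar {α S : Type*} (ρ : α → S → S → Prop)
    (l : Language α) (R : S → S → Prop)
    (hR : ∀ x y, R x y ↔ ∃ w ∈ l, relOfWord ρ w x y) (x y : S) :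
    Relation.ReflTransGen R x y ↔ ∃ w ∈ KStar.kstar l, relOfWord ρ w x y := by
  constructor
  · intro h
    induction h using Relation.ReflTransGen.head_induction_on with
    | refl => exact ⟨[], Language.nil_mem_kstar l, rfl⟩
    | head hstep _ ih =>
      obtain ⟨u, hu, hxu⟩ := (hR _ _).1 hstep
      obtain ⟨v, hv, hvy⟩ := ih
      refine ⟨u ++ v, mul_kstar_le_kstar (a := l) (Language.append_mem_mul hu hv), ?_⟩
      rw [relOfWord_append]
      exact ⟨_, hxu, hvy⟩
  · rintro ⟨w, hw, hxy⟩
    obtain ⟨L, rfl, hL⟩ := Language.mem_kstar.1 hw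
    clear hw
    induction L generalizing x with
    | nil => cases hxy; exact .refl
    | cons u L ih =>
      rw [List.flatten_cons, relOfWord_append] at hxy
      obtain ⟨z, hxz, hzy⟩ := hxy
      exact .head ((hR _ _).2 ⟨u, hL u List.mem_cons_self, hxz⟩)
        (ih z (fun v hv => hL v (List.mem_cons_of_mem u hv)) hzy)

theorem interp_iff_exists_word {α S : Type*} (ρ : α → S → S → Prop)
    (e : RegularExpression α) (x y : S) :
    interp ρ e x y ↔ ∃ w ∈ e.matches', relOfWord ρ w x y := by
  induction e generalizing x y with
  | zero => exact ⟨False.elim, fun ⟨_, hw, _⟩ => hw⟩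
  | epsilon =>
    refine ⟨fun h => ⟨[], rfl, h⟩, ?_⟩
    rintro ⟨w, hw, h⟩
    cases (Language.mem_one w).1 hw
    exact h
  | char c =>
    refine ⟨fun h => ⟨[c], rfl, y, h, rfl⟩, ?_⟩
    rintro ⟨w, hw, h⟩
    cases (Set.mem_singleton_iff.1 hw : w = [c])
    obtain ⟨z, hz, rfl⟩ := h
    exact hz
  | plus p q ihp ihq =>
    change interp ρ p x y ∨ interp ρ q x y ↔
      ∃ w, (w ∈ p.matches' ∨ w ∈ q.matches') ∧ relOfWord ρ w x y
    simp only [ihp, ihq, or_and_right, exists_or]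
  | comp p q ihp ihq =>
    change (∃ z, interp ρ p x z ∧ interp ρ q z y) ↔
      ∃ w ∈ p.matches' * q.matches', relOfWord ρ w x y
    simp only [ihp, ihq, Language.mem_mul]
    constructor
    · rintro ⟨z, ⟨u, hu, hxz⟩, v, hv, hzy⟩
      refine ⟨u ++ v, ⟨u, hu, v, hv, rfl⟩, ?_⟩
      rw [relOfWord_append]
      exact ⟨z, hxz, hzy⟩
    · rintro ⟨_, ⟨u, hu, v, hv, rfl⟩, h⟩
      rw [relOfWord_append] at h
      obtain ⟨z, hxz, hzy⟩ := h
      exact ⟨z, ⟨u, hu, hxz⟩, v, hv, hzy⟩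
  | star p ih => exact reflTransGen_iff_exists_mem_kstar ρ _ _ ih x y
end

section
/- Consider the guarded transition step on ℤ × ℤ given by (x, y) → (x − 1, y + x) enabled when x > 0 and y > 0. For any sequence of states starting at (x₁, y₁) with x₁ ≥ 0 and y₁ ≥ 0 and ending at a state (x', y') (each consecutive pair related by step), the final values satisfy 0 ≤ x' ≤ x₁ and 2*y₁ − x₁² ≤ 2*y' ≤ 2*y₁ + x₁ + 2*x₁². -/
/-- The guarded transition step on `ℤ × ℤ`: `(x, y) → (x - 1, y + x)`,
enabled when `x > 0` and `y > 0`. -/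
def whStep (p q : ℤ × ℤ) : Prop :=
  p.1 > 0 ∧ p.2 > 0 ∧ q.1 = p.1 - 1 ∧ q.2 = p.2 + p.1

/-- Along a path of `whStep`s from a state with `x ≥ 0`, the coordinate `x` stays nonnegative and
does not increase, `y` does not decrease, and `2 * y + x * (x + 1)` is conserved. -/
theorem whStep_path_invariant (s : ℕ → ℤ × ℤ) (hx : 0 ≤ (s 0).1) (k : ℕ)
    (hpath : ∀ i < k, whStep (s i) (s (i + 1))) :
    0 ≤ (s k).1 ∧ (s k).1 ≤ (s 0).1 ∧ (s 0).2 ≤ (s k).2 ∧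
      2 * (s k).2 + (s k).1 * ((s k).1 + 1) = 2 * (s 0).2 + (s 0).1 * ((s 0).1 + 1) := by
  induction k with
  | zero => exact ⟨hx, le_rfl, le_rfl, rfl⟩
  | succ k ih =>
    obtain ⟨h₀, h₁, h₂, h₃⟩ := ih fun i hi => hpath i (hi.trans k.lt_succ_self)
    obtain ⟨hpos, -, hfst, hsnd⟩ := hpath k k.lt_succ_self
    rw [hfst, hsnd]
    exact ⟨by lia, by lia, by lia, by linarith⟩

theorem wh_interval_bounds (x₁ y₁ x' y' : ℤ) (hx : x₁ ≥ 0) (hy : y₁ ≥ 0)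
    (k : ℕ) (s : ℕ → ℤ × ℤ) (hstart : s 0 = (x₁, y₁)) (hend : s k = (x', y'))
    (hpath : ∀ i < k, whStep (s i) (s (i + 1))) :
    0 ≤ x' ∧ x' ≤ x₁ ∧ 2 * y₁ - x₁ ^ 2 ≤ 2 * y' ∧ 2 * y' ≤ 2 * y₁ + x₁ + 2 * x₁ ^ 2 := by
  have hinv := whStep_path_invariant s (by simpa [hstart] using hx) k hpath
  simp only [hstart, hend] at hinv
  obtain ⟨h₀, h₁, h₂, h₃⟩ := hinv
  exact ⟨h₀, h₁, by nlinarith, by nlinarith⟩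
end

section
/- Consider the two guarded transitions on ℤ × ℤ: c₁: (a, b) → (a, b − 1) enabled when a > 0 and b > 0, and c₂: (a, b) → (a − 1, b + a) enabled when a > 0 and b ≤ 0. For any finite sequence of states starting at (a₀, b₀) with a₀ ≥ 0 and b₀ ≥ 0, where each consecutive pair is related by c₁ or c₂, and whose final state (a'', b'') satisfies a'' ≤ 0: the final state satisfies a'' = 0 and 2*b'' ≤ 2*b₀ + a₀*(a₀ + 1). -/
/-- Transition `c₁` on `ℤ × ℤ`: `(a, b) → (a, b - 1)`, enabled when `a > 0` and `b > 0`. -/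
def c1Step (p q : ℤ × ℤ) : Prop :=
  p.1 > 0 ∧ p.2 > 0 ∧ q.1 = p.1 ∧ q.2 = p.2 - 1

/-- Transition `c₂` on `ℤ × ℤ`: `(a, b) → (a - 1, b + a)`, enabled when `a > 0` and `b ≤ 0`. -/
def c2Step (p q : ℤ × ℤ) : Prop :=
  p.1 > 0 ∧ p.2 ≤ 0 ∧ q.1 = p.1 - 1 ∧ q.2 = p.2 + p.1

/-- Along a path of `c₁` and `c₂` transitions the first component stays nonnegative and the
potential `2 * b + a * (a + 1)` does not increase. -/
theorem potential_le_of_path (k : ℕ) (s : ℕ → ℤ × ℤ) (ha : 0 ≤ (s 0).1)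
    (hpath : ∀ i < k, c1Step (s i) (s (i + 1)) ∨ c2Step (s i) (s (i + 1))) :
    0 ≤ (s k).1 ∧
      2 * (s k).2 + (s k).1 * ((s k).1 + 1) ≤ 2 * (s 0).2 + (s 0).1 * ((s 0).1 + 1) := by
  induction k with
  | zero => exact ⟨ha, le_rfl⟩
  | succ n ih =>
    obtain ⟨-, hle⟩ := ih fun i hi => hpath i (by omega)
    rcases hpath n (by omega) with ⟨hpos, -, h1, h2⟩ | ⟨hpos, -, h1, h2⟩ <;> rw [h1, h2]
    · exact ⟨hpos.le, by linarith⟩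
    · exact ⟨by omega, by linarith⟩

theorem wh_multipath_final_bounds (a₀ b₀ a'' b'' : ℤ) (ha : a₀ ≥ 0) (hb : b₀ ≥ 0)
    (k : ℕ) (s : ℕ → ℤ × ℤ) (hstart : s 0 = (a₀, b₀)) (hend : s k = (a'', b''))
    (hpath : ∀ i < k, c1Step (s i) (s (i + 1)) ∨ c2Step (s i) (s (i + 1)))
    (hfinal : a'' ≤ 0) :
    a'' = 0 ∧ 2 * b'' ≤ 2 * b₀ + a₀ * (a₀ + 1) := by
  have h := potential_le_of_path k s (by simpa [hstart] using ha) hpath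
  rw [hstart, hend] at h
  obtain ⟨hnonneg, hle⟩ := h
  obtain rfl : a'' = 0 := le_antisymm hfinal hnonneg
  exact ⟨rfl, by simpa using hle⟩
end

section
/- Consider the two guarded transitions on ℤ × ℤ: c₁: (a, b) → (a, b − 1) enabled when a > 0 and b > 0, and c₂: (a, b) → (a − 1, b + a) enabled when a > 0 and b ≤ 0. There is no infinite sequence of states s₀, s₁, s₂, … in ℤ × ℤ such that every consecutive pair sₙ, sₙ₊₁ is related by c₁ or c₂; i.e., every execution of this two-path loop terminates. -/
/-- Every step of the loop strictly decreases `(a, b)`, truncated to naturals, lexicographically. -/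
theorem lex_toNat_lt_of_step {p q : ℤ × ℤ} (h : c1Step p q ∨ c2Step p q) :
    toLex (q.1.toNat, q.2.toNat) < toLex (p.1.toNat, p.2.toNat) := by
  rw [Prod.Lex.toLex_lt_toLex]
  simp only [c1Step, c2Step] at h
  omega

theorem wh_multipath_terminates :
    ¬ ∃ s : ℕ → ℤ × ℤ, ∀ n : ℕ, c1Step (s n) (s (n + 1)) ∨ c2Step (s n) (s (n + 1)) := by
  rintro ⟨s, hs⟩
  exact (wellFounded_iff_isEmpty_descending_chain.mp
    (wellFounded_lt (α := ℕ ×ₗ ℕ))).false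
    ⟨fun n => toLex ((s n).1.toNat, (s n).2.toNat), fun n => lex_toNat_lt_of_step (hs n)⟩
end

section
/- Let W : ℤ → ℤ → ℤ satisfy W x y = x + y + 1 + W (x−1) (y+1) whenever x > 0 and W x y = 0 whenever x ≤ 0. Then for all x, y : ℤ with x ≥ 0: W x y = x * (x + y + 1). -/
theorem wh_closed_form (W : ℤ → ℤ → ℤ)
    (hWrec : ∀ x y : ℤ, x > 0 → W x y = x + y + 1 + W (x - 1) (y + 1))
    (hWbase : ∀ x y : ℤ, x ≤ 0 → W x y = 0) :
    ∀ x y : ℤ, x ≥ 0 → W x y = x * (x + y + 1) := by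
  intro x y hx
  induction x, hx using Int.leInduction generalizing y with
  | base => simp [hWbase 0 y le_rfl]
  | succ n hn ih =>
    rw [hWrec _ _ (by omega), add_sub_cancel_right, ih]
    ring
end
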